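/- For every integer m ≥ 2 there exists an exact m-cover ℬ = {a_t(n_t)}_{t=1}^{s} of ℤ with the following property: for every partition of ℬ into two subsystems ℬ₁ and ℬ₂, there exists an integer x such that one of the subsystems covers x exactly m times and the other covers x zero times, i.e., {w_{ℬ₁}(x), w_{ℬ₂}(x)} = {m, 0}. -/

import Mathlib

/-- The covering function of the subsystem `{a_t (n_t) : t ∈ I}` of a system of
residue classes: `coverFun a n I x` is the number of `t ∈ I` with `x ∈ a_t (n_t)`. -/
noncomputable def coverFun {s : ℕ} (a : Fin s → ℤ) (n : Fin s → ℕ)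
    (I : Finset (Fin s)) (x : ℤ) : ℕ :=
  (I.filter fun t => x ≡ a t [ZMOD (n t : ℤ)]).card

/-- The graph obtained from `m` disjoint copies of `G` by attaching, for each family
`c : Fin m → Finset V`, a complete graph on `m` new vertices, the `j`-th of which is joined to
`c j` in the `j`-th copy of `G` whenever `c j` has `k` elements. -/
def attachCliques {V : Type} (G : SimpleGraph V) (m k : ℕ) :
    SimpleGraph (Fin m × V ⊕ (Fin m → Finset V) × Fin m) where
  Adj x y :=
    match x, y with
    | .inl (i, u), .inl (j, v) => i = j ∧ G.Adj u v
    | .inl (i, u), .inr (c, j) => i = j ∧ u ∈ c j ∧ (c j).card = k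
    | .inr (c, j), .inl (i, u) => i = j ∧ u ∈ c j ∧ (c j).card = k
    | .inr (c, i), .inr (d, j) => c = d ∧ i ≠ j
  symm := ⟨by
    rintro (⟨i, u⟩ | ⟨c, i⟩) (⟨j, v⟩ | ⟨d, j⟩) h
    · exact ⟨h.1.symm, h.2.symm⟩
    · exact h
    · exact h
    · exact ⟨h.1.symm, h.2.symm⟩⟩
  loopless := ⟨by
    rintro (⟨i, u⟩ | ⟨c, i⟩) h
    · exact G.irrefl h.2
    · exact h.2 rfl⟩

lemma attachCliques_cliqueFree {V : Type} {G : SimpleGraph V} {m k : ℕ}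
    (hG : G.CliqueFree (m + 1)) (hk : k < m) : (attachCliques G m k).CliqueFree (m + 1) := by
  classical
  intro K hK
  have hadj : ∀ x ∈ K, ∀ y ∈ K, x ≠ y → (attachCliques G m k).Adj x y :=
    fun x hx y hy h => hK.isClique hx hy h
  have hcard := hK.card_eq
  by_cases hr : ∃ c j, Sum.inr (c, j) ∈ K
  · obtain ⟨c, j, hcj⟩ := hr
    by_cases hl : ∃ i u, Sum.inl (i, u) ∈ K
    · obtain ⟨i, u, hiu⟩ := hl
      have hck : (c j).card = k := (hadj _ hcj _ hiu (by simp)).2.2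
      have hsub : K ⊆ insert (Sum.inr (c, j)) ((c j).image fun v => Sum.inl (j, v)) := by
        rintro (⟨i', v⟩ | ⟨d, j'⟩) hx
        · have h := hadj _ hx _ hcj (by simp)
          obtain ⟨rfl, hv, -⟩ := h
          simp [hv]
        · by_contra hne
          have hne' : (Sum.inr (d, j') : Fin m × V ⊕ (Fin m → Finset V) × Fin m) ≠
              Sum.inr (c, j) := fun h => hne (by simp [h])
          have h₁ := (hadj _ hx _ hcj hne').2
          have h₂ := (hadj _ hiu _ hx (by simp)).1
          have h₃ := (hadj _ hiu _ hcj (by simp)).1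
          exact h₁ (h₂.symm.trans h₃)
      have h₁ := Finset.card_le_card hsub
      have h₂ := Finset.card_insert_le (Sum.inr (c, j) : Fin m × V ⊕ (Fin m → Finset V) × Fin m)
        ((c j).image fun v => Sum.inl (j, v))
      have h₃ := Finset.card_image_le (s := c j)
        (f := fun v => (Sum.inl (j, v) : Fin m × V ⊕ (Fin m → Finset V) × Fin m))
      omega
    · have hsub : K ⊆ Finset.univ.image fun i => Sum.inr (c, i) := by
        rintro (⟨i, v⟩ | ⟨d, i⟩) hx
        · exact (hl ⟨i, v, hx⟩).elim
        · by_cases h : (d, i) = (c, j)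
          · simp [h]
          · have := (hadj _ hx _ hcj (by simpa using h)).1
            simp [this]
      have h₁ := Finset.card_le_card hsub
      have h₂ := Finset.card_image_le (s := (Finset.univ : Finset (Fin m)))
        (f := fun i => (Sum.inr (c, i) : Fin m × V ⊕ (Fin m → Finset V) × Fin m))
      simp only [Finset.card_univ, Fintype.card_fin] at h₂
      omega
  · obtain ⟨x, hx⟩ : K.Nonempty := Finset.card_pos.mp (by omega)
    obtain ⟨i, u⟩ | ⟨c, j⟩ := x
    swap
    · exact hr ⟨c, j, hx⟩
    have hsub : ∀ y ∈ K, ∃ v, y = Sum.inl (i, v) := by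
      rintro (⟨i', v⟩ | ⟨d, j⟩) hy
      · by_cases h : (i', v) = (i, u)
        · exact ⟨u, by rw [h]⟩
        · have := (hadj _ hy _ hx (by simpa using h)).1
          exact ⟨v, by rw [this]⟩
      · exact (hr ⟨d, j, hy⟩).elim
    have hinj : Set.InjOn (Sum.elim Prod.snd fun _ => u)
        (↑K : Set (Fin m × V ⊕ (Fin m → Finset V) × Fin m)) := by
      intro y hy z hz h
      obtain ⟨v, rfl⟩ := hsub y hy
      obtain ⟨w, rfl⟩ := hsub z hz
      simpa using h
    refine hG (K.image (Sum.elim Prod.snd fun _ => u)) ⟨?_, ?_⟩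
    · intro v hv w hw hvw
      simp only [Finset.coe_image, Set.mem_image] at hv hw
      obtain ⟨y, hy, rfl⟩ := hv
      obtain ⟨z, hz, rfl⟩ := hw
      have h := hadj _ hy _ hz fun h => hvw (by rw [h])
      obtain ⟨v, rfl⟩ := hsub y hy
      obtain ⟨w, rfl⟩ := hsub z hz
      exact h.2
    · rw [Finset.card_image_of_injOn hinj, hcard]

/-- An asymmetric vertex Folkman theorem: there is a finite graph without `(m + 1)`-cliques in
which every set of vertices contains a `k`-clique or has an `m`-clique in its complement. -/
lemma exists_vertexFolkman (m k : ℕ) (hk : k ≤ m) :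
    ∃ (V : Type) (_ : Fintype V) (G : SimpleGraph V), G.CliqueFree (m + 1) ∧
      ∀ C : Set V, (∃ K, G.IsNClique k K ∧ ∀ v ∈ K, v ∈ C) ∨
        ∃ K, G.IsNClique m K ∧ ∀ v ∈ K, v ∉ C := by
  classical
  induction k with
  | zero =>
    refine ⟨Empty, inferInstance, ⊥, fun K hK => ?_, fun C => Or.inl ⟨∅, by simp, by simp⟩⟩
    have := hK.card_eq
    simp [Finset.eq_empty_of_isEmpty K] at this
  | succ k ih =>
    obtain ⟨V, _, G, hfree, hG⟩ := ih (by omega)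
    refine ⟨_, inferInstance, attachCliques G m k, attachCliques_cliqueFree hfree (by omega),
      fun C => ?_⟩
    by_cases hblue : ∃ j K, G.IsNClique m K ∧ ∀ v ∈ K, Sum.inl (j, v) ∉ C
    · obtain ⟨j, K, hK, hKC⟩ := hblue
      refine Or.inr ⟨K.image fun v => Sum.inl (j, v), ⟨?_, ?_⟩, by simpa using hKC⟩
      · intro x hx y hy hxy
        simp only [Finset.coe_image, Set.mem_image] at hx hy
        obtain ⟨v, hv, rfl⟩ := hx
        obtain ⟨w, hw, rfl⟩ := hy
        exact ⟨rfl, hK.isClique hv hw fun h => hxy (by rw [h])⟩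
      · rw [Finset.card_image_of_injective _ fun v w h => by simpa using h, hK.card_eq]
    have hred : ∀ j, ∃ K, G.IsNClique k K ∧ ∀ v ∈ K, Sum.inl (j, v) ∈ C := fun j =>
      (hG {v | Sum.inl (j, v) ∈ C}).resolve_right fun ⟨K, hK⟩ => hblue ⟨j, K, hK⟩
    choose c hc hcC using hred
    by_cases hj : ∃ j, Sum.inr (c, j) ∈ C
    · obtain ⟨j, hj⟩ := hj
      refine Or.inl ⟨insert (Sum.inr (c, j)) ((c j).image fun v => Sum.inl (j, v)), ?_, ?_⟩
      · refine SimpleGraph.IsNClique.insert ⟨?_, ?_⟩ ?_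
        · intro x hx y hy hxy
          simp only [Finset.coe_image, Set.mem_image] at hx hy
          obtain ⟨v, hv, rfl⟩ := hx
          obtain ⟨w, hw, rfl⟩ := hy
          exact ⟨rfl, (hc j).isClique hv hw fun h => hxy (by rw [h])⟩
        · rw [Finset.card_image_of_injective _ fun v w h => by simpa using h, (hc j).card_eq]
        · intro x hx
          obtain ⟨v, hv, rfl⟩ := Finset.mem_image.mp hx
          exact ⟨rfl, hv, (hc j).card_eq⟩
      · intro x hx
        obtain rfl | hx := Finset.mem_insert.mp hx
        · exact hj
        · obtain ⟨v, hv, rfl⟩ := Finset.mem_image.mp hx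
          exact hcC j v hv
    · push Not at hj
      refine Or.inr ⟨Finset.univ.image fun i => Sum.inr (c, i), ⟨?_, ?_⟩, by simpa using hj⟩
      · intro x hx y hy hxy
        simp only [Finset.coe_image, Set.mem_image] at hx hy
        obtain ⟨i, -, rfl⟩ := hx
        obtain ⟨j, -, rfl⟩ := hy
        exact ⟨rfl, fun h => hxy (by rw [h])⟩
      · rw [Finset.card_image_of_injective _ fun v w h => by simpa using h]
        simp

/-- Every finite graph is the intersection graph of a system of residue classes. -/
lemma exists_residueClasses_of_graph {V : Type} [Fintype V] (G : SimpleGraph V) :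
    ∃ (a : V → ℤ) (n : V → ℕ), (∀ v, 0 < n v) ∧
      (∀ K : Set V, G.IsClique K → ∃ x : ℤ, ∀ v ∈ K, x ≡ a v [ZMOD (n v : ℤ)]) ∧
      ∀ x : ℤ, G.IsClique {v | x ≡ a v [ZMOD (n v : ℤ)]} := by
  classical
  let p : V × V → ℕ := fun e => Nat.nth Nat.Prime (Fintype.equivFin (V × V) e)
  have hp : ∀ e, (p e).Prime := fun e => Nat.prime_nth_prime _
  have hinj : Function.Injective p := fun e f h =>
    (Fintype.equivFin (V × V)).injective
      (Fin.ext (Nat.nth_injective Nat.infinite_setOfPred_prime h))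
  have hcop : Pairwise (Function.onFun Nat.Coprime p) := fun e f h =>
    (Nat.coprime_primes (hp e) (hp f)).mpr (hinj.ne h)
  have hcrt : ∀ K : Set V, ∃ x : ℕ, ∀ e, x ≡ (if e.1 ∈ K then 0 else 1) [MOD p e] := fun K =>
    let y := Nat.chineseRemainderOfFinset (fun e : V × V => if e.1 ∈ K then 0 else 1) p
      Finset.univ (fun e _ => (hp e).ne_zero) fun e _ f _ h => hcop h
    ⟨y, fun e => y.2 e (Finset.mem_univ e)⟩
  choose X hX using hcrt
  let E : V → Finset (V × V) := fun v =>
    {e | (e.1 ≠ e.2 ∧ ¬ G.Adj e.1 e.2) ∧ (e.1 = v ∨ e.2 = v)}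
  refine ⟨fun v => X {v}, fun v => ∏ e ∈ E v, p e,
    fun v => Finset.prod_pos fun e _ => (hp e).pos, fun K hK => ⟨X K, fun v hv => ?_⟩,
    fun x u hu v hv huv => ?_⟩
  · refine Int.natCast_modEq_iff.mpr (Nat.modEq_iff_dvd.mpr ?_)
    push_cast
    refine Finset.prod_dvd_of_coprime
      (fun e _ f _ h => Nat.isCoprime_iff_coprime.mpr (hcop h)) fun e he => ?_
    refine (Nat.modEq_iff_dvd).mp ((hX K e).trans (Nat.ModEq.trans ?_ (hX {v} e).symm))
    obtain ⟨⟨hne, hnadj⟩, rfl | rfl⟩ := (Finset.mem_filter.mp he).2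
    · simp [hv, Nat.ModEq.refl]
    · have : e.1 ∉ K := fun h => hnadj (hK h hv hne)
      simp [this, hne, Nat.ModEq.refl]
  · by_contra hadj
    have hdvd : ∀ w, (u, v) ∈ E w → (p (u, v) : ℤ) ∣ ((∏ e ∈ E w, p e : ℕ) : ℤ) := fun w hw =>
      Int.natCast_dvd_natCast.mpr (Finset.dvd_prod_of_mem p hw)
    have h₁ : x ≡ X {u} [ZMOD p (u, v)] :=
      Int.ModEq.of_dvd (hdvd u (by simp [E, huv, hadj])) hu
    have h₂ : x ≡ X {v} [ZMOD p (u, v)] :=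
      Int.ModEq.of_dvd (hdvd v (by simp [E, huv, hadj])) hv
    have h := Int.natCast_modEq_iff.mp (h₁.symm.trans h₂)
    have h₀ := ((hX {u} (u, v)).symm.trans h).trans (hX {v} (u, v))
    simp only [Set.mem_singleton_iff, huv, if_true, if_false] at h₀
    exact (hp (u, v)).one_lt.ne' (Nat.dvd_one.mp ((Nat.modEq_zero_iff_dvd).mp h₀.symm))

/-- A system of residue classes covering no integer more than `m` times extends to an exact
`m`-cover. -/
lemma exists_exactCover_extension {V : Type} [Fintype V] (m : ℕ) (a : V → ℤ) (n : V → ℕ)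
    (hn : ∀ v, 0 < n v)
    (hm : ∀ x : ℤ, Fintype.card {v // x ≡ a v [ZMOD (n v : ℤ)]} ≤ m) :
    ∃ (s : ℕ) (a' : Fin s → ℤ) (n' : Fin s → ℕ) (f : V ↪ Fin s),
      (∀ t, 0 < n' t) ∧ (∀ x, coverFun a' n' Finset.univ x = m) ∧
      ∀ v, a' (f v) = a v ∧ n' (f v) = n v := by
  classical
  let N : ℕ := ∏ v, n v
  have hN : 0 < N := Finset.prod_pos fun v _ => hn v
  let w : ℤ → ℕ := fun x => Fintype.card {v // x ≡ a v [ZMOD (n v : ℤ)]}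
  have hw : ∀ x y : ℤ, x ≡ y [ZMOD (N : ℤ)] → w x = w y := fun x y h => by
    refine Fintype.card_congr (Equiv.subtypeEquivRight fun v => ?_)
    have hv : x ≡ y [ZMOD (n v : ℤ)] :=
      h.of_dvd (Int.natCast_dvd_natCast.mpr (Finset.dvd_prod_of_mem n (Finset.mem_univ v)))
    exact ⟨hv.symm.trans, hv.trans⟩
  let ι := V ⊕ Σ r : Fin N, Fin (m - w r)
  let e : ι ≃ Fin (Fintype.card ι) := Fintype.equivFin ι
  let A : ι → ℤ := Sum.elim a fun q => (q.1 : ℤ)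
  let M : ι → ℕ := Sum.elim n fun _ => N
  refine ⟨Fintype.card ι, A ∘ e.symm, M ∘ e.symm, Function.Embedding.inl.trans e.toEmbedding,
    fun t => ?_, fun x => ?_, fun v => by simp [A, M]⟩
  · rcases h : e.symm t with v | q
    · simpa [M, h] using hn v
    · simpa [M, h] using hN
  · let r₀ : Fin N := ⟨(x % N).toNat, by
      have := Int.emod_lt_of_pos x (Int.natCast_pos.mpr hN)
      have := Int.emod_nonneg x (Int.natCast_pos.mpr hN).ne'
      omega⟩
    have hr₀ : ((r₀ : ℕ) : ℤ) = x % N :=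
      Int.toNat_of_nonneg (Int.emod_nonneg x (Int.natCast_pos.mpr hN).ne')
    have hx : x ≡ (r₀ : ℕ) [ZMOD (N : ℤ)] := by rw [hr₀]; exact (Int.mod_modEq x N).symm
    have huniq : ∀ r : Fin N, x ≡ (r : ℕ) [ZMOD (N : ℤ)] ↔ r = r₀ := fun r => by
      refine ⟨fun h => Fin.ext ?_, fun h => h ▸ hx⟩
      exact (Int.natCast_modEq_iff.mp (h.symm.trans hx)).eq_of_lt_of_lt r.2 r₀.2
    have h₁ : coverFun (A ∘ e.symm) (M ∘ e.symm) Finset.univ x =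
        Fintype.card {i // x ≡ A i [ZMOD (M i : ℤ)]} := by
      rw [coverFun, ← Fintype.card_subtype]
      exact Fintype.card_congr (e.symm.subtypeEquiv fun t => Iff.rfl)
    have h₂ : Fintype.card {q : Σ r : Fin N, Fin (m - w r) // x ≡ (q.1 : ℕ) [ZMOD (N : ℤ)]} =
        m - w r₀ := by
      refine (Fintype.card_congr ?_).trans (Fintype.card_fin _)
      exact (Equiv.subtypeEquivRight fun (q : Σ r : Fin N, Fin (m - w r)) => huniq q.1).trans
        (Equiv.sigmaSubtype r₀)
    have h₃ := Fintype.card_congr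
      (Equiv.subtypeSum (p := fun i : ι => x ≡ A i [ZMOD (M i : ℤ)]))
    rw [h₁, h₃, Fintype.card_sum]
    have h₄ := hw _ _ hx
    have h₅ := hm x
    change w x + Fintype.card
      {q : Σ r : Fin N, Fin (m - w r) // x ≡ (q.1 : ℕ) [ZMOD (N : ℤ)]} = m
    change w x ≤ m at h₅
    omega

lemma coverFun_add_coverFun_compl {s : ℕ} (a : Fin s → ℤ) (n : Fin s → ℕ)
    (I : Finset (Fin s)) (x : ℤ) :
    coverFun a n I x + coverFun a n Iᶜ x = coverFun a n Finset.univ x := by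
  classical
  rw [coverFun, coverFun, coverFun, ← Finset.card_union_of_disjoint
    (Finset.disjoint_filter_filter disjoint_compl_right), ← Finset.filter_union,
    Finset.union_compl]

/-- For every `m ≥ 2` there exists an exact `m`-cover
`ℬ = {a_t (n_t)}_{t=1}^s` of `ℤ` such that for every partition of `ℬ` into
subsystems `ℬ₁ = {a_t(n_t) : t ∈ I}` and `ℬ₂ = {a_t(n_t) : t ∉ I}` there is an
integer `x` covered exactly `m` times by one subsystem and `0` times by the other. -/
theorem stmt12 (m : ℕ) (hm : 2 ≤ m) :
    ∃ (s : ℕ) (a : Fin s → ℤ) (n : Fin s → ℕ),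
      (∀ t, 0 < n t) ∧
      (∀ x : ℤ, coverFun a n Finset.univ x = m) ∧
      ∀ I : Finset (Fin s), ∃ x : ℤ,
        (coverFun a n I x = m ∧ coverFun a n Iᶜ x = 0) ∨
        (coverFun a n I x = 0 ∧ coverFun a n Iᶜ x = m) := by
  classical
  obtain ⟨V, _, G, hfree, hG⟩ := exists_vertexFolkman m m le_rfl
  obtain ⟨a, n, hn, hcommon, hclique⟩ := exists_residueClasses_of_graph G
  have hle : ∀ x : ℤ, Fintype.card {v // x ≡ a v [ZMOD (n v : ℤ)]} ≤ m := fun x => by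
    by_contra! h
    rw [Fintype.card_subtype] at h
    refine SimpleGraph.CliqueFree.mono h hfree {v | x ≡ a v [ZMOD (n v : ℤ)]} ⟨?_, rfl⟩
    simpa using hclique x
  obtain ⟨s, a', n', f, hn', hcover, hf⟩ := exists_exactCover_extension m a n hn hle
  refine ⟨s, a', n', hn', hcover, fun I => ?_⟩
  have key : ∀ (J : Finset (Fin s)) (K : Finset V), G.IsNClique m K → (∀ v ∈ K, f v ∈ J) →
      ∃ x, m ≤ coverFun a' n' J x := fun J K hK hKJ => by
    obtain ⟨x, hx⟩ := hcommon K hK.isClique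
    refine ⟨x, ?_⟩
    rw [← hK.card_eq, ← Finset.card_map f]
    refine Finset.card_le_card fun t ht => ?_
    obtain ⟨v, hv, rfl⟩ := Finset.mem_map.mp ht
    rw [Finset.mem_filter, (hf v).1, (hf v).2]
    exact ⟨hKJ v hv, hx v hv⟩
  obtain ⟨K, hK, hKI⟩ | ⟨K, hK, hKI⟩ := hG {v | f v ∈ I}
  · obtain ⟨x, hx⟩ := key I K hK hKI
    have h₁ := coverFun_add_coverFun_compl a' n' I x
    have h₂ := hcover x
    exact ⟨x, Or.inl (by omega)⟩
  · obtain ⟨x, hx⟩ := key Iᶜ K hK fun v hv => Finset.mem_compl.mpr (hKI v hv)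
    have h₁ := coverFun_add_coverFun_compl a' n' I x
    have h₂ := hcover x
    exact ⟨x, Or.inr (by omega)⟩
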